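/- arXiv:2505.07632 — 3 statements merged into one kernel-verified Lean document; each statement's English description precedes it below -/
import Mathlib

section
/- Let V be a finite-dimensional ℚ-vector space and F ⊆ V_ℂ a complex linear subspace such that V_ℝ ∩ F = {0}. Let q : V_ℂ → V_ℂ/F be the quotient map. Then there exists a ℚ-linear subspace L ⊆ V such that V_ℂ/F, regarded as a real vector space, is the internal direct sum of the real subspaces q(V_ℝ) and q(i·L_ℝ), where L_ℝ denotes the ℝ-span of L in V_ℂ and i·L_ℝ = {i·x : x ∈ L_ℝ}; that is, q(V_ℝ) + q(i·L_ℝ) = V_ℂ/F and q(V_ℝ) ∩ q(i·L_ℝ) = {0}. -/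
open scoped TensorProduct

/-- An additive map `f` from a rational vector space to a real one whose image spans together with
a real subspace `A`: some rational subspace `L` has `f '' L` spanning a complement of `A`. -/
theorem exists_rat_submodule_isCompl_span_image {V W : Type*} [AddCommGroup V] [Module ℚ V]
    [AddCommGroup W] [Module ℝ W] (A : Submodule ℝ W) (f : V →+ W)
    (hf : A ⊔ Submodule.span ℝ (Set.range f) = ⊤) :
    ∃ L : Submodule ℚ V, IsCompl A (Submodule.span ℝ (f '' (L : Set V))) := by
  obtain ⟨κ, a, -, hspan, hli⟩ := exists_linearIndependent' ℝ (fun v => A.mkQ (f v))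
  have hL : Submodule.span ℝ (f '' (Submodule.span ℚ (Set.range a) : Set V)) =
      Submodule.span ℝ (Set.range (f ∘ a)) := by
    apply le_antisymm
    · rw [Submodule.span_le]
      rintro _ ⟨v, hv, rfl⟩
      induction hv using Submodule.span_induction with
      | mem x hx =>
        obtain ⟨k, rfl⟩ := hx
        exact Submodule.subset_span ⟨k, rfl⟩
      | zero => simp
      | add x y _ _ hx hy =>
        rw [map_add]
        exact add_mem hx hy
      | smul c x _ hx =>
        have h := map_ratCast_smul f ℚ ℝ c x
        rw [Rat.cast_id] at h
        rw [h]
        exact Submodule.smul_mem _ _ hx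
    · refine Submodule.span_mono ?_
      rintro _ ⟨k, rfl⟩
      exact ⟨a k, Submodule.subset_span ⟨k, rfl⟩, rfl⟩
  refine ⟨Submodule.span ℚ (Set.range a), ?_⟩
  rw [hL]
  constructor
  · rw [Submodule.disjoint_def]
    intro x hxA hx
    obtain ⟨l, rfl⟩ := (Finsupp.mem_span_range_iff_exists_finsupp).1 hx
    have h0 := (Submodule.Quotient.mk_eq_zero A).2 hxA
    rw [← Submodule.mkQ_apply, map_finsuppSum] at h0
    have hl : l = 0 := by
      refine linearIndependent_iff.1 hli l ?_
      rw [Finsupp.linearCombination_apply, ← h0]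
      simp
    simp [hl]
  · rw [codisjoint_iff, eq_top_iff, ← hf]
    refine sup_le le_sup_left ?_
    have hmap : (Submodule.span ℝ (Set.range f)).map A.mkQ =
        (Submodule.span ℝ (Set.range (f ∘ a))).map A.mkQ := by
      rw [Submodule.map_span, Submodule.map_span, ← Set.range_comp, ← Set.range_comp]
      exact hspan.symm
    rw [← A.comap_map_mkQ, ← hmap]
    exact Submodule.le_comap_map _ _

/-- Let `V` be a finite-dimensional `ℚ`-vector space, `V_ℂ := ℂ ⊗[ℚ] V`
its complexification, and `V_ℝ ⊆ V_ℂ` the real span of the image of `V` (the copy of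
`ℝ ⊗[ℚ] V`).  If `F ⊆ V_ℂ` is a complex subspace with `V_ℝ ∩ F = {0}` and
`q : V_ℂ → V_ℂ/F` is the quotient map, then there is a `ℚ`-subspace `L ⊆ V` such that
`V_ℂ/F` is the internal direct sum of the real subspaces `q(V_ℝ)` and `q(i·L_ℝ)`. -/
theorem stmt_0 (V : Type*) [AddCommGroup V] [Module ℚ V] [FiniteDimensional ℚ V]
    (F : Submodule ℂ (ℂ ⊗[ℚ] V))
    (hF : ((Submodule.span ℝ (Set.range ⇑(TensorProduct.mk ℚ ℂ V 1)) :
        Submodule ℝ (ℂ ⊗[ℚ] V)) : Set (ℂ ⊗[ℚ] V)) ∩ (F : Set (ℂ ⊗[ℚ] V)) = {0}) :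
    ∃ L : Submodule ℚ V,
      (Submodule.span ℝ (⇑F.mkQ '' Set.range ⇑(TensorProduct.mk ℚ ℂ V 1)) ⊔
        Submodule.span ℝ
          (⇑F.mkQ '' ((Complex.I • ·) '' (⇑(TensorProduct.mk ℚ ℂ V 1) '' (L : Set V)))) = ⊤) ∧
      (Submodule.span ℝ (⇑F.mkQ '' Set.range ⇑(TensorProduct.mk ℚ ℂ V 1)) ⊓
        Submodule.span ℝ
          (⇑F.mkQ '' ((Complex.I • ·) '' (⇑(TensorProduct.mk ℚ ℂ V 1) '' (L : Set V)))) = ⊥) := by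
  let f : V →+ (ℂ ⊗[ℚ] V) ⧸ F := F.mkQ.toAddMonoidHom.comp
    ((DistribSMul.toAddMonoidHom (ℂ ⊗[ℚ] V) Complex.I).comp
      (TensorProduct.mk ℚ ℂ V 1).toAddMonoidHom)
  have hf : Submodule.span ℝ (⇑F.mkQ '' Set.range ⇑(TensorProduct.mk ℚ ℂ V 1)) ⊔
      Submodule.span ℝ (Set.range f) = ⊤ := by
    rw [eq_top_iff]
    rintro x -
    obtain ⟨y, rfl⟩ := F.mkQ_surjective x
    induction y using TensorProduct.induction_on with
    | zero => simp
    | add x y hx hy =>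
      rw [map_add]
      exact add_mem hx hy
    | tmul z v =>
      have hz : z ⊗ₜ[ℚ] v = z.re • ((1 : ℂ) ⊗ₜ[ℚ] v) + z.im • (Complex.I • ((1 : ℂ) ⊗ₜ[ℚ] v)) := by
        simp only [TensorProduct.smul_tmul', ← TensorProduct.add_tmul]
        congr 1
        apply Complex.ext <;> simp
      have hq : F.mkQ (z ⊗ₜ[ℚ] v) = z.re • F.mkQ ((1 : ℂ) ⊗ₜ[ℚ] v) + z.im • f v := by
        rw [hz]
        rfl
      rw [hq]
      exact add_mem
        (Submodule.mem_sup_left (Submodule.smul_mem _ _ (Submodule.subset_span ⟨_, ⟨v, rfl⟩, rfl⟩)))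
        (Submodule.mem_sup_right (Submodule.smul_mem _ _ (Submodule.subset_span ⟨v, rfl⟩)))
  obtain ⟨L, hL⟩ := exists_rat_submodule_isCompl_span_image _ f hf
  have himage : ⇑F.mkQ '' ((Complex.I • ·) '' (⇑(TensorProduct.mk ℚ ℂ V 1) '' (L : Set V))) =
      f '' (L : Set V) := by
    rw [Set.image_image, Set.image_image]
    rfl
  refine ⟨L, ?_⟩
  rw [himage]
  exact ⟨hL.sup_eq_top, hL.inf_eq_bot⟩
end

section
/- Let F ⊆ V_ℂ be a complex linear subspace with F ∩ σ(F) = {0}, and let Λ ⊆ V_ℝ be a discrete additive subgroup. Then the quotient map q : V_ℂ → V_ℂ/F is injective on Λ, the image q(Λ) is a discrete additive subgroup of the finite-dimensional real topological vector space V_ℂ/F, and the action of Λ on V_ℂ/F by translations (λ acting as x ↦ x + q(λ)) is properly discontinuous. -/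
/-- A conjugation-fixed vector of a subspace that meets its conjugate trivially is zero. -/
theorem eq_zero_of_fixed_of_mem {E : Type*} [AddCommGroup E] [Module ℂ E] {σ : E →ₗ[ℝ] E}
    {F : Submodule ℂ E} (hF : (F : Set E) ∩ ⇑σ '' (F : Set E) = {0}) {x : E}
    (hx : σ x = x) (hxF : x ∈ F) : x = 0 := by
  have h : x ∈ (F : Set E) ∩ ⇑σ '' (F : Set E) := ⟨hxF, x, hxF, hx⟩
  simpa [hF] using h

/-- The quotient map by a subspace meeting its conjugate trivially restricts to a closed embedding
on every discrete subgroup of conjugation-fixed vectors. -/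
theorem isClosedEmbedding_mkQ_of_fixed {E : Type*} [NormedAddCommGroup E] [NormedSpace ℂ E]
    [FiniteDimensional ℂ E] {σ : E →ₗ[ℝ] E} {Λ : AddSubgroup E} (hΛ : ∀ x ∈ Λ, σ x = x)
    [DiscreteTopology Λ] {F : Submodule ℂ E} (hF : (F : Set E) ∩ ⇑σ '' (F : Set E) = {0}) :
    Topology.IsClosedEmbedding (fun γ : Λ => F.mkQ (γ : E)) := by
  have : FiniteDimensional ℝ E := FiniteDimensional.complexToReal E
  have : IsClosed (F : Set E) := F.closed_of_finiteDimensional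
  let W : Submodule ℝ E := LinearMap.eqLocus σ LinearMap.id
  let f : W →ₗ[ℝ] E ⧸ F := (F.mkQ.restrictScalars ℝ).comp W.subtype
  have hf : LinearMap.ker f = ⊥ := by
    refine LinearMap.ker_eq_bot'.2 fun w hw => Subtype.ext ?_
    exact eq_zero_of_fixed_of_mem hF w.2 ((Submodule.Quotient.mk_eq_zero F).1 hw)
  have hfe : Topology.IsClosedEmbedding f := LinearMap.isClosedEmbedding_of_injective hf
  have hW : Topology.IsClosedEmbedding (Subtype.val : W → E) :=
    W.closed_of_finiteDimensional.isClosedEmbedding_subtypeVal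
  have hΛE : Topology.IsClosedEmbedding (Subtype.val : Λ → E) :=
    Λ.isClosed_of_discrete.isClosedEmbedding_subtypeVal
  let i : Λ → W := fun γ => ⟨γ, hΛ γ γ.2⟩
  have hi : Topology.IsClosedEmbedding i := (hW.of_comp_iff (f := i)).1 hΛE
  exact hfe.comp hi


/-- Let `E` be a finite-dimensional complex vector space (with its
standard topology, given by a norm) equipped with a conjugation `σ`, i.e. a
conjugate-linear involution; its fixed-point set is the real form `V_ℝ`, so that `E`
is the complexification of `V_ℝ`.  Let `F ⊆ E` be a complex subspace with
`F ∩ σ(F) = {0}`, and let `Λ ⊆ V_ℝ` be a discrete additive subgroup.  Then the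
quotient map `q : E → E/F` is injective on `Λ`, the image `q(Λ)` is a discrete
additive subgroup of the finite-dimensional real topological vector space `E/F`,
and the translation action of `Λ` on `E/F` (with `λ` acting by `x ↦ q(λ) + x`) is
properly discontinuous. -/
theorem stmt_3 (E : Type*) [NormedAddCommGroup E] [NormedSpace ℂ E]
    [FiniteDimensional ℂ E]
    (σ : E →ₗ[ℝ] E) (hσ_inv : ∀ x, σ (σ x) = x)
    (hσ_conj : ∀ (c : ℂ) (x : E), σ (c • x) = (starRingEnd ℂ) c • σ x)
    (Λ : AddSubgroup E) (hΛreal : ∀ x ∈ Λ, σ x = x) (hΛdisc : DiscreteTopology ↥Λ)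
    (F : Submodule ℂ E) (hF : (F : Set E) ∩ ⇑σ '' (F : Set E) = {0}) :
    Set.InjOn ⇑F.mkQ (Λ : Set E) ∧
    DiscreteTopology ↥(AddSubgroup.map F.mkQ.toAddMonoidHom Λ) ∧
    ∀ K L : Set (E ⧸ F), IsCompact K → IsCompact L →
      {γ : ↥Λ | ((fun x => F.mkQ ↑γ + x) '' K) ∩ L ≠ ∅}.Finite := by
  have hg := isClosedEmbedding_mkQ_of_fixed hΛreal hF
  refine ⟨Set.injOn_iff_injective.2 hg.injective, ?_, fun K L hK hL => ?_⟩
  · have hrange : Set.range (fun γ : Λ => F.mkQ (γ : E)) =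
        (AddSubgroup.map F.mkQ.toAddMonoidHom Λ : Set (E ⧸ F)) := by
      ext y
      simp
    have hdisc : DiscreteTopology (Set.range fun γ : Λ => F.mkQ (γ : E)) :=
      hg.isEmbedding.toHomeomorph.symm.isEmbedding.discreteTopology
    rw [hrange] at hdisc
    exact hdisc
  · have hLK := (hL.prod hK).image (continuous_fst.sub continuous_snd)
    refine (hg.isCompact_preimage hLK).finite_of_discrete.subset fun γ hγ => ?_
    obtain ⟨_, ⟨x, hx, rfl⟩, hxL⟩ := Set.nonempty_iff_ne_empty.2 hγ
    exact ⟨(_, x), ⟨hxL, hx⟩, add_sub_cancel_right _ _⟩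
end

section
/- Let f : ℂ → ℂ be an entire function (complex differentiable on all of ℂ). Identify ℂ² with ℝ⁴ via (z, w) ↦ (Re z, Im z, Re w, Im w). If the graph {(z, f(z)) : z ∈ ℂ} is a semialgebraic subset of ℝ⁴, then f is a polynomial: there exists P ∈ ℂ[X] with f(z) = P(z) for all z ∈ ℂ. -/
/-- A subset `S ⊆ ℝ^k` is semialgebraic if it is a finite union of sets of the form
`{x : p₁(x) = ⋯ = p_a(x) = 0, q₁(x) > 0, …, q_b(x) > 0}` for real polynomials
`p_i, q_j` in `k` variables. -/
def IsSemialgebraic {k : ℕ} (S : Set (Fin k → ℝ)) : Prop :=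
  ∃ (n : ℕ) (f : Fin n → Set (Fin k → ℝ)),
    (∀ i, ∃ P Q : Finset (MvPolynomial (Fin k) ℝ),
      f i = {x | (∀ p ∈ P, MvPolynomial.eval x p = 0) ∧
                 (∀ q ∈ Q, 0 < MvPolynomial.eval x q)}) ∧
    S = ⋃ i, f i

open Polynomial Filter Topology in
/-- An entire function of polynomial growth is a polynomial. -/
theorem exists_polynomial_of_norm_le {f : ℂ → ℂ} (hf : Differentiable ℂ f) (B R₀ : ℝ) (N : ℕ)
    (h : ∀ z, R₀ ≤ ‖z‖ → ‖f z‖ ≤ B * ‖z‖ ^ N) :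
    ∃ P : Polynomial ℂ, ∀ z : ℂ, f z = P.eval z := by
  have hzero : ∀ n, n ∉ Finset.range (N + 1) → iteratedDeriv n f 0 = 0 := by
    intro n hn
    obtain ⟨m, rfl⟩ : ∃ m, n = N + (m + 1) := by
      rw [Finset.mem_range] at hn
      exact ⟨n - N - 1, by omega⟩
    have hlim : Tendsto (fun R : ℝ ↦ ((N + (m + 1)).factorial * B) * (R ^ (m + 1))⁻¹) atTop
        (𝓝 (((N + (m + 1)).factorial * B) * 0)) :=
      ((tendsto_pow_atTop (Nat.succ_ne_zero m)).inv_tendsto_atTop).const_mul _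
    rw [mul_zero] at hlim
    rw [← norm_le_zero_iff]
    refine ge_of_tendsto hlim ?_
    filter_upwards [eventually_ge_atTop R₀, eventually_gt_atTop 0] with R hR hpos
    refine (Complex.norm_iteratedDeriv_le_of_forall_mem_sphere_norm_le (C := B * R ^ N) _ hpos
      hf.diffContOnCl fun z hz ↦ ?_).trans_eq ?_
    · rw [mem_sphere_zero_iff_norm] at hz
      simpa [hz] using h z (hz ▸ hR)
    · field_simp
      ring
  refine ⟨∑ n ∈ Finset.range (N + 1), C ((n.factorial : ℂ)⁻¹ * iteratedDeriv n f 0) * X ^ n,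
    fun z ↦ ?_⟩
  rw [← Complex.taylorSeries_eq_of_entire' 0 z hf,
    tsum_eq_sum (s := Finset.range (N + 1)) fun n hn ↦ by simp [hzero n hn]]
  simp [eval_finsetSum]

theorem Polynomial.exists_norm_eval_le (p : Polynomial ℂ) :
    ∃ C : ℝ, 0 ≤ C ∧ ∀ z, 1 ≤ ‖z‖ → ‖p.eval z‖ ≤ C * ‖z‖ ^ p.natDegree := by
  refine ⟨∑ i ∈ Finset.range (p.natDegree + 1), ‖p.coeff i‖, by positivity, fun z hz ↦ ?_⟩
  rw [p.eval_eq_sum_range, Finset.sum_mul]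
  refine (norm_sum_le _ _).trans (Finset.sum_le_sum fun i hi ↦ ?_)
  rw [norm_mul, norm_pow]
  gcongr
  exact Nat.lt_succ_iff.mp (Finset.mem_range.mp hi)

open Filter in
theorem Polynomial.exists_le_norm_eval {p : Polynomial ℂ} (hp : p ≠ 0) :
    ∃ c R₀ : ℝ, 0 < c ∧ ∀ z, R₀ ≤ ‖z‖ → c ≤ ‖p.eval z‖ := by
  rcases le_or_gt p.degree 0 with h | h
  · rw [Polynomial.eq_C_of_degree_le_zero h] at hp ⊢
    refine ⟨‖p.coeff 0‖, 0, ?_, fun z _ ↦ by simp⟩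
    simpa using hp
  · have ht := p.tendsto_norm_atTop h (l := comap norm atTop) (z := fun z : ℂ ↦ z) tendsto_comap
    obtain ⟨R₀, hR₀⟩ := eventually_atTop.mp (eventually_comap.mp (ht.eventually_ge_atTop 1))
    exact ⟨1, R₀, one_pos, fun z hz ↦ hR₀ ‖z‖ hz z rfl⟩

open Polynomial in
/-- An entire function that is algebraic over `ℂ[z]` is a polynomial. -/
theorem exists_polynomial_of_evalEval_eq_zero {f : ℂ → ℂ} (hf : Differentiable ℂ f)
    {A : ℂ[X][X]} (hA : A ≠ 0) (h : ∀ z, A.evalEval z (f z) = 0) :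
    ∃ P : Polynomial ℂ, ∀ z : ℂ, f z = P.eval z := by
  obtain ⟨c, R₀, hc, hlead⟩ := exists_le_norm_eval (leadingCoeff_ne_zero.mpr hA)
  choose C hC0 hC using fun k ↦ (A.coeff k).exists_norm_eval_le
  set N := ∑ k ∈ Finset.range A.natDegree, (A.coeff k).natDegree with hN
  set B := ∑ k ∈ Finset.range A.natDegree, C k with hB
  have hB0 : 0 ≤ B := Finset.sum_nonneg fun k _ ↦ hC0 k
  refine exists_polynomial_of_norm_le hf (1 + B / c) (max R₀ 1) N fun z hz ↦ ?_
  have hz1 : 1 ≤ ‖z‖ := (le_max_right _ _).trans hz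
  have hzN : 1 ≤ ‖z‖ ^ N := one_le_pow₀ hz1
  have hcz := hlead z ((le_max_left _ _).trans hz)
  have hBc : 0 ≤ B / c := by positivity
  rcases le_or_gt ‖f z‖ 1 with h1 | h1
  · nlinarith
  have hrel := h z
  rw [evalEval, eval_eq_sum_range (p := A), eval_finsetSum, Finset.sum_range_succ] at hrel
  simp only [eval_mul, eval_pow, eval_C] at hrel
  have hkey : c * ‖f z‖ ^ A.natDegree
      ≤ ∑ k ∈ Finset.range A.natDegree, C k * ‖z‖ ^ N * ‖f z‖ ^ (A.natDegree - 1) := by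
    calc c * ‖f z‖ ^ A.natDegree
        ≤ ‖(A.coeff A.natDegree).eval z‖ * ‖f z‖ ^ A.natDegree := by gcongr; exact hcz
      _ = ‖∑ k ∈ Finset.range A.natDegree, (A.coeff k).eval z * f z ^ k‖ := by
          rw [eq_neg_of_add_eq_zero_left hrel, norm_neg, norm_mul, norm_pow]
      _ ≤ _ := by
          refine (norm_sum_le _ _).trans (Finset.sum_le_sum fun k hk ↦ ?_)
          rw [norm_mul, norm_pow]
          have hkN : (A.coeff k).natDegree ≤ N :=
            Finset.single_le_sum (f := fun k ↦ (A.coeff k).natDegree) (fun _ _ ↦ Nat.zero_le _) hk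
          have hkd : k ≤ A.natDegree - 1 := by
            have := Finset.mem_range.mp hk
            omega
          have hCk := hC0 k
          refine mul_le_mul ((hC k z hz1).trans ?_) (pow_le_pow_right₀ h1.le hkd)
            (by positivity) (by positivity)
          gcongr
  rw [← Finset.sum_mul, ← Finset.sum_mul, ← hB] at hkey
  rcases Nat.eq_zero_or_pos A.natDegree with hd | hd
  · simp [hB, hd] at hkey
    linarith
  obtain ⟨d, hd⟩ := Nat.exists_eq_succ_of_ne_zero hd.ne'
  rw [hd, Nat.succ_sub_one, pow_succ', ← mul_assoc] at hkey
  have hfin := le_of_mul_le_mul_right hkey (by positivity)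
  have : ‖f z‖ ≤ B / c * ‖z‖ ^ N := by
    rw [div_mul_eq_mul_div, le_div_iff₀ hc]
    linarith
  linarith

/-- Evaluating a polynomial in several variables after substituting bivariate
polynomials for the variables. -/
theorem MvPolynomial.evalEval_aeval {σ : Type*} (p : MvPolynomial σ ℝ)
    (v : σ → Polynomial (Polynomial ℂ)) (z w : ℂ) :
    (MvPolynomial.aeval v p).evalEval z w
      = MvPolynomial.aeval (fun i ↦ (v i).evalEval z w) p := by
  induction p using MvPolynomial.induction_on with
  | C a =>
    simp [IsScalarTower.algebraMap_apply ℝ ℂ (Polynomial (Polynomial ℂ)),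
      Polynomial.algebraMap_apply, Polynomial.evalEval]
  | add p q hp hq => simp [hp, hq, Polynomial.evalEval_add]
  | mul_X p i hp => simp [hp, Polynomial.evalEval_mul]

theorem Differentiable.mvPolynomial_aeval {σ : Type*} (p : MvPolynomial σ ℝ)
    {v : σ → ℂ → ℂ} (hv : ∀ i, Differentiable ℂ (v i)) :
    Differentiable ℂ fun s ↦ MvPolynomial.aeval (fun i ↦ v i s) p := by
  induction p using MvPolynomial.induction_on with
  | C a => simp
  | add p q hp hq => simpa only [map_add] using hp.fun_add hq
  | mul_X p i hp => simpa only [map_mul, MvPolynomial.aeval_X] using hp.fun_mul (hv i)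

open Filter Topology in
/-- An entire function vanishing on the real line vanishes identically. -/
theorem Differentiable.eq_zero_of_forall_real {H : ℂ → ℂ} (hH : Differentiable ℂ H)
    (h : ∀ x : ℝ, H x = 0) (z : ℂ) : H z = 0 := by
  have hfreq : ∃ᶠ z in 𝓝[≠] (0 : ℂ), H z = (fun _ ↦ 0 : ℂ → ℂ) z := by
    have ht : Tendsto (fun x : ℝ ↦ (x : ℂ)) (𝓝[≠] 0) (𝓝[≠] 0) := by
      refine tendsto_nhdsWithin_iff.mpr ⟨?_, ?_⟩
      · exact (Complex.continuous_ofReal.tendsto' 0 0 (by simp)).mono_left nhdsWithin_le_nhds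
      · filter_upwards [self_mem_nhdsWithin] with x hx
        simpa using hx
    exact ht.frequently (Eventually.frequently (Eventually.of_forall h))
  exact congrFun (AnalyticOnNhd.eq_of_frequently_eq (fun x _ ↦ hH.analyticAt x)
    (fun x _ ↦ analyticAt_const) hfreq) z

open Complex ComplexConjugate

theorem differentiable_conj_conj {f : ℂ → ℂ} (hf : Differentiable ℂ f) :
    Differentiable ℂ fun z ↦ conj (f (conj z)) := fun z ↦ by
  simpa [Function.comp_def] using (hf (conj z)).conj_conj

/-- A real polynomial vanishing on the graph of an entire function also vanishes on the
polarized (complexified) graph. -/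
theorem aeval_polarized_graph_eq_zero {f : ℂ → ℂ} (hf : Differentiable ℂ f)
    {p : MvPolynomial (Fin 4) ℝ}
    (hp : ∀ z : ℂ, MvPolynomial.eval ![z.re, z.im, (f z).re, (f z).im] p = 0) (z ζ : ℂ) :
    MvPolynomial.aeval ![(z + ζ) / 2, (z - ζ) / (2 * I), (f z + conj (f (conj ζ))) / 2,
      (f z - conj (f (conj ζ))) / (2 * I)] p = 0 := by
  set g : ℂ → ℂ := fun z ↦ conj (f (conj z)) with hg
  have hgd : Differentiable ℂ g := differentiable_conj_conj hf
  let H : ℂ → ℂ → ℂ := fun s t ↦ MvPolynomial.aeval ![s, t,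
    (f (s + t * I) + g (s - t * I)) / 2, (f (s + t * I) - g (s - t * I)) / (2 * I)] p
  have hfun : ∀ a b c d : ℂ → ℂ, Differentiable ℂ a → Differentiable ℂ b → Differentiable ℂ c →
      Differentiable ℂ d →
      Differentiable ℂ fun s ↦ MvPolynomial.aeval ![a s, b s, c s, d s] p := by
    intro a b c d ha hb hc hd
    have := Differentiable.mvPolynomial_aeval p (v := ![a, b, c, d])
      (by intro i; fin_cases i <;> assumption)
    convert this using 4 with s
    funext i
    fin_cases i <;> rfl
  have hreal : ∀ s t : ℝ, H s t = 0 := by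
    intro s t
    have h0 := hp (s + t * I)
    have hgc : g (s - t * I) = conj (f (s + t * I)) := by simp [hg]
    have hv : ![(s : ℂ), (t : ℂ), (f (s + t * I) + g (s - t * I)) / 2,
        (f (s + t * I) - g (s - t * I)) / (2 * I)] = fun i ↦ algebraMap ℝ ℂ
        (![(s + t * I : ℂ).re, (s + t * I : ℂ).im, (f (s + t * I)).re, (f (s + t * I)).im] i) := by
      rw [hgc]
      funext i
      fin_cases i
      · simp
      · simp
      · simp [Complex.add_conj]
      · simp only [Complex.sub_conj]
        simp [mul_right_comm _ _ I, mul_div_cancel_left₀]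
    simp only [H]
    rw [hv]
    rw [← MvPolynomial.coe_aeval_eq_eval] at h0
    have := MvPolynomial.aeval_algebraMap_apply ℂ
      ![(s + t * I : ℂ).re, (s + t * I : ℂ).im, (f (s + t * I)).re, (f (s + t * I)).im] p
    exact this.trans (by erw [h0]; simp)
  have h1 : ∀ (s : ℂ) (t : ℝ), H s t = 0 := fun s t ↦
    Differentiable.eq_zero_of_forall_real (H := fun s ↦ H s t)
      (hfun _ _ _ _ (by fun_prop) (by fun_prop) (by fun_prop) (by fun_prop))
      (fun x ↦ hreal x t) s
  have h2 : ∀ s t : ℂ, H s t = 0 := fun s t ↦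
    Differentiable.eq_zero_of_forall_real (H := fun t ↦ H s t)
      (hfun _ _ _ _ (by fun_prop) (by fun_prop) (by fun_prop) (by fun_prop))
      (fun x ↦ h1 s x) t
  have e1 : (z + ζ) / 2 + (z - ζ) / (2 * I) * I = z := by field_simp; ring
  have e2 : (z + ζ) / 2 - (z - ζ) / (2 * I) * I = ζ := by field_simp; ring
  have := h2 ((z + ζ) / 2) ((z - ζ) / (2 * I))
  simp only [H, e1, e2] at this
  exact this

open Polynomial in
/-- If an entire function is not a polynomial, no nonzero real polynomial vanishes on its graph. -/
theorem eq_zero_of_forall_eval_graph_eq_zero {f : ℂ → ℂ} (hf : Differentiable ℂ f)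
    (hnp : ¬ ∃ P : Polynomial ℂ, ∀ z : ℂ, f z = P.eval z) {p : MvPolynomial (Fin 4) ℝ}
    (hp : ∀ z : ℂ, MvPolynomial.eval ![z.re, z.im, (f z).re, (f z).im] p = 0) : p = 0 := by
  set g : ℂ → ℂ := fun z ↦ conj (f (conj z)) with hg
  have hgd : Differentiable ℂ g := differentiable_conj_conj hf
  have hgnp : ¬ ∃ P : ℂ[X], ∀ z : ℂ, g z = P.eval z := by
    rintro ⟨P, hP⟩
    refine hnp ⟨P.map (starRingEnd ℂ), fun z ↦ ?_⟩
    have := congrArg conj (hP (conj z))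
    rw [← eval_map_apply] at this
    simpa [hg] using this
  have hft : ∀ A : ℂ[X][X], (∀ z, A.evalEval z (f z) = 0) → A = 0 := fun A hA ↦
    by_contra fun h ↦ hnp (exists_polynomial_of_evalEval_eq_zero hf h hA)
  have hgt : ∀ A : ℂ[X][X], (∀ z, A.evalEval z (g z) = 0) → A = 0 := fun A hA ↦
    by_contra fun h ↦ hgnp (exists_polynomial_of_evalEval_eq_zero hgd h hA)
  have h0 := aeval_polarized_graph_eq_zero hf hp
  let κ : ℂ → ℂ[X][X] := fun c ↦ C (C c)
  have h1 : ∀ z w ζ : ℂ, MvPolynomial.aeval ![(z + ζ) / 2, (z - ζ) / (2 * I), (w + g ζ) / 2,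
      (w - g ζ) / (2 * I)] p = 0 := by
    intro z w ζ
    let v : Fin 4 → ℂ[X][X] := ![(C X + κ ζ) * κ (1 / 2), (C X - κ ζ) * κ (1 / (2 * I)),
      (X + κ (g ζ)) * κ (1 / 2), (X - κ (g ζ)) * κ (1 / (2 * I))]
    have hv : ∀ z w : ℂ, (fun i ↦ (v i).evalEval z w) = ![(z + ζ) / 2, (z - ζ) / (2 * I),
        (w + g ζ) / 2, (w - g ζ) / (2 * I)] := by
      intro z w
      funext i
      fin_cases i <;> simp [v, κ, evalEval, div_eq_mul_inv]
    have hA := hft (MvPolynomial.aeval v p) fun z ↦ by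
      rw [MvPolynomial.evalEval_aeval, hv]; exact h0 z ζ
    rw [← hv, ← MvPolynomial.evalEval_aeval, hA, evalEval_zero]
  have h2 : ∀ z w ζ ω : ℂ, MvPolynomial.aeval ![(z + ζ) / 2, (z - ζ) / (2 * I), (w + ω) / 2,
      (w - ω) / (2 * I)] p = 0 := by
    intro z w ζ ω
    let v : Fin 4 → ℂ[X][X] := ![(κ z + C X) * κ (1 / 2), (κ z - C X) * κ (1 / (2 * I)),
      (κ w + X) * κ (1 / 2), (κ w - X) * κ (1 / (2 * I))]
    have hv : ∀ ζ ω : ℂ, (fun i ↦ (v i).evalEval ζ ω) = ![(z + ζ) / 2, (z - ζ) / (2 * I),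
        (w + ω) / 2, (w - ω) / (2 * I)] := by
      intro ζ ω
      funext i
      fin_cases i <;> simp [v, κ, evalEval, div_eq_mul_inv]
    have hA := hgt (MvPolynomial.aeval v p) fun ζ ↦ by
      rw [MvPolynomial.evalEval_aeval, hv]; exact h1 z w ζ
    rw [← hv, ← MvPolynomial.evalEval_aeval, hA, evalEval_zero]
  refine MvPolynomial.funext fun x ↦ ?_
  have hx := h2 (x 0 + x 1 * I) (x 2 + x 3 * I) (x 0 - x 1 * I) (x 2 - x 3 * I)
  have hvec : ![((x 0 + x 1 * I) + (x 0 - x 1 * I)) / 2,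
      ((x 0 + x 1 * I) - (x 0 - x 1 * I)) / (2 * I), ((x 2 + x 3 * I) + (x 2 - x 3 * I)) / 2,
      ((x 2 + x 3 * I) - (x 2 - x 3 * I)) / (2 * I)] = fun i ↦ algebraMap ℝ ℂ (x i) := by
    funext i
    fin_cases i <;> simp <;> field_simp <;> ring
  rw [hvec] at hx
  have := (MvPolynomial.aeval_algebraMap_apply ℂ x p).symm.trans hx
  simpa [MvPolynomial.coe_aeval_eq_eval] using this

theorem isOpen_setOf_forall_eval_pos {k : ℕ} (Q : Finset (MvPolynomial (Fin k) ℝ)) :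
    IsOpen {x : Fin k → ℝ | ∀ q ∈ Q, 0 < MvPolynomial.eval x q} := by
  have : {x : Fin k → ℝ | ∀ q ∈ Q, 0 < MvPolynomial.eval x q}
      = ⋂ q ∈ Q, {x | 0 < MvPolynomial.eval x q} := by ext; simp
  rw [this]
  exact isOpen_biInter_finset fun q _ ↦ isOpen_lt continuous_const (MvPolynomial.continuous_eval q)

open Filter Topology in
/-- The graph of a function `ℂ → ℂ` contains no nonempty open subset of `ℝ⁴`. -/
theorem eq_empty_of_isOpen_of_subset_graph {f : ℂ → ℂ} {U : Set (Fin 4 → ℝ)} (hU : IsOpen U)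
    (hsub : U ⊆ {v : Fin 4 → ℝ | ∃ z : ℂ, v = ![z.re, z.im, (f z).re, (f z).im]}) : U = ∅ := by
  by_contra hne
  obtain ⟨v, hv⟩ := Set.nonempty_iff_ne_empty.mpr hne
  have hcont : Tendsto (fun t : ℝ ↦ Function.update v 3 t) (𝓝[≠] (v 3)) (𝓝 v) := by
    have : Continuous fun t : ℝ ↦ Function.update v 3 t := by fun_prop
    exact (this.tendsto' (v 3) v (by simp)).mono_left nhdsWithin_le_nhds
  obtain ⟨t, htU, ht⟩ :=
    ((hcont.eventually (hU.mem_nhds hv)).and self_mem_nhdsWithin).exists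
  obtain ⟨z, hz⟩ := hsub hv
  obtain ⟨z', hz'⟩ := hsub htU
  have hzz : z' = z := by
    apply Complex.ext
    · simpa [hz] using (congrFun hz' 0).symm
    · simpa [hz] using (congrFun hz' 1).symm
  apply ht
  have h3 := congrFun hz' 3
  simpa [hz, hzz] using h3

/-- Let `f : ℂ → ℂ` be an entire function.  Identify `ℂ²` with `ℝ⁴`
via `(z, w) ↦ (Re z, Im z, Re w, Im w)`.  If the graph `{(z, f z) : z ∈ ℂ}` is a
semialgebraic subset of `ℝ⁴`, then `f` is a polynomial. -/
theorem stmt_7 (f : ℂ → ℂ) (hf : Differentiable ℂ f)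
    (hgraph : IsSemialgebraic
      {v : Fin 4 → ℝ | ∃ z : ℂ, v = ![z.re, z.im, (f z).re, (f z).im]}) :
    ∃ P : Polynomial ℂ, ∀ z : ℂ, f z = P.eval z := by
  by_contra hnp
  obtain ⟨n, S, hS, hunion⟩ := hgraph
  have hex : ∀ i, ∃ p : MvPolynomial (Fin 4) ℝ, p ≠ 0 ∧
      ∀ x ∈ S i, MvPolynomial.eval x p = 0 := by
    intro i
    obtain ⟨P, Q, hPQ⟩ := hS i
    by_contra! hno
    have hP : ∀ p ∈ P, p = 0 := fun p hp ↦ by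
      by_contra h
      obtain ⟨x, hx, hne⟩ := hno p h
      rw [hPQ] at hx
      exact hne (hx.1 p hp)
    have hSi : S i = {x | ∀ q ∈ Q, 0 < MvPolynomial.eval x q} := by
      rw [hPQ]
      ext x
      simp only [Set.mem_ofPred_eq, and_iff_right_iff_imp]
      intro _ p hp
      simp [hP p hp]
    have hempty : S i = ∅ := eq_empty_of_isOpen_of_subset_graph (f := f)
      (hSi ▸ isOpen_setOf_forall_eval_pos Q) (hunion ▸ Set.subset_iUnion S i)
    obtain ⟨x, hx, -⟩ := hno 1 one_ne_zero
    simp [hempty] at hx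
  choose p hp0 hp using hex
  refine Finset.prod_ne_zero_iff.mpr (fun i _ ↦ hp0 i)
    (eq_zero_of_forall_eval_graph_eq_zero hf hnp (p := ∏ i, p i) fun z ↦ ?_)
  have hz : ![z.re, z.im, (f z).re, (f z).im] ∈ ⋃ i, S i := hunion ▸ ⟨z, rfl⟩
  obtain ⟨i, hi⟩ := Set.mem_iUnion.mp hz
  rw [map_prod]
  exact Finset.prod_eq_zero (Finset.mem_univ i) (hp i _ hi)
end
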